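/- (Singleton) If there exists an (n,k) circuit code of length N with k ≥ 2 and k even, then there exists an (n + (k+2)/2, k) circuit code of length N + (k+2)⌊N/(k+1)⌋. -/

import Mathlib

/-- The cyclic distance between two positions on a cycle of length `N`:
the minimum of the two arc lengths. -/
def cycDist {N : ℕ} (i j : ZMod N) : ℕ := min (j - i).val (i - j).val

/-- `C` is an `(n,k)` circuit code of length `N`: a cyclic sequence of `N` distinct
vertices of the hypercube `I(n)` forming an induced cycle such that vertices at
Hamming distance `< k` are at equal cyclic distance. -/
structure IsCircuitCode (n k N : ℕ) (C : ZMod N → (Fin n → Bool)) : Prop where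
  inj : Function.Injective C
  adj : ∀ i : ZMod N, hammingDist (C i) (C (i + 1)) = 1
  induced : ∀ i j : ZMod N, i ≠ j → j ≠ i + 1 → i ≠ j + 1 →
    hammingDist (C i) (C j) ≠ 1
  spread : ∀ i j : ZMod N, hammingDist (C i) (C j) < k →
    cycDist i j = hammingDist (C i) (C j)

/-- There exists an `(n,k)` circuit code of length `N`. -/
def ExistsCircuitCode (n k N : ℕ) : Prop :=
  ∃ C : ZMod N → (Fin n → Bool), IsCircuitCode n k N C

/-- `K n k` is the maximum length of an `(n,k)` circuit code. -/
noncomputable def K (n k : ℕ) : ℕ := sSup {N | ExistsCircuitCode n k N}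

theorem cycDist_comm {N : ℕ} (i j : ZMod N) : cycDist i j = cycDist j i :=
  min_comm _ _

theorem cycDist_natCast {N : ℕ} [NeZero N] {a b : ℕ} (hab : a ≤ b) (hb : b ≤ a + N) :
    cycDist (a : ZMod N) (b : ZMod N) = min (b - a) (N - (b - a)) := by
  have h₁ : (b : ZMod N) - a = ((b - a : ℕ) : ZMod N) := by rw [Nat.cast_sub hab]
  have h₂ : (a : ZMod N) - b = ((N - (b - a) : ℕ) : ZMod N) := by
    rw [Nat.cast_sub (by omega), Nat.cast_sub hab, ZMod.natCast_self]
    ring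
  unfold cycDist
  rw [h₁, h₂, ZMod.val_natCast, ZMod.val_natCast]
  have hN : 0 < N := NeZero.pos N
  rcases Nat.eq_zero_or_pos (b - a) with h | h
  · simp [h]
  rcases Nat.lt_or_ge (b - a) N with h' | h'
  · rw [Nat.mod_eq_of_lt h', Nat.mod_eq_of_lt (by omega)]
  · have : b - a = N := by omega
    simp [this]

theorem hammingDist_append {m n : ℕ} (u v : Fin m → Bool) (x y : Fin n → Bool) :
    hammingDist (Fin.append u x) (Fin.append v y) = hammingDist u v + hammingDist x y := by
  simp only [hammingDist, Finset.card_filter, Fin.sum_univ_add, Fin.append_left,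
    Fin.append_right]

theorem hammingDist_le_sub_of_step {n : ℕ} {f : ℕ → Fin n → Bool}
    (hf : ∀ i, hammingDist (f i) (f (i + 1)) ≤ 1) {a b : ℕ} (hab : a ≤ b) :
    hammingDist (f a) (f b) ≤ b - a := by
  induction b, hab using Nat.le_induction with
  | base => simp
  | succ b hab ih =>
    have := hammingDist_triangle (f a) (f b) (f (b + 1))
    have := hf b
    omega

/-- The vertices of the isometric cycle of length `2 * m` in the `m`-dimensional hypercube. -/
def isometricCycle (m s : ℕ) : Fin m → Bool := fun j => decide ((s + j) / m % 2 = 1)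

theorem isometricCycle_step (m s : ℕ) :
    hammingDist (isometricCycle m s) (isometricCycle m (s + 1)) ≤ 1 := by
  rw [hammingDist, Finset.card_le_one]
  have key : ∀ j ∈ Finset.univ.filter
      (fun j => isometricCycle m s j ≠ isometricCycle m (s + 1) j), m ∣ s + j + 1 := by
    intro j hj
    by_contra h
    rw [Finset.mem_filter] at hj
    apply hj.2
    simp only [isometricCycle]
    rw [show s + 1 + (j : ℕ) = s + j + 1 by ring, Nat.succ_div, if_neg h, add_zero]
  intro i hi j hj
  have hmod := (Nat.modEq_zero_iff_dvd.2 (key i hi)).trans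
    (Nat.modEq_zero_iff_dvd.2 (key j hj)).symm
  exact Fin.ext (Nat.ModEq.eq_of_lt_of_lt
    (Nat.ModEq.add_left_cancel' s (Nat.ModEq.add_right_cancel' 1 hmod)) i.2 j.2)

theorem isometricCycle_add_self (m s : ℕ) (j : Fin m) :
    isometricCycle m (s + m) j = !isometricCycle m s j := by
  simp only [isometricCycle]
  rw [show s + m + (j : ℕ) = s + j + m by ring, Nat.add_div_right _ j.pos]
  rcases Nat.mod_two_eq_zero_or_one ((s + j) / m) with h | h <;> simp [Nat.succ_mod_two_eq_one_iff, h]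

theorem isometricCycle_add_two_mul (m s q : ℕ) :
    isometricCycle m (s + 2 * m * q) = isometricCycle m s := by
  induction q with
  | zero => simp
  | succ q ih =>
    rw [← ih]
    funext j
    rw [show s + 2 * m * (q + 1) = s + 2 * m * q + m + m by ring, isometricCycle_add_self,
      isometricCycle_add_self, Bool.not_not]

theorem hammingDist_isometricCycle_of_le {m d : ℕ} (s : ℕ) (hd : d ≤ m) :
    hammingDist (isometricCycle m s) (isometricCycle m (s + d)) = d := by
  have hstep := isometricCycle_step m
  have h₁ := hammingDist_le_sub_of_step hstep (Nat.le_add_right s d)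
  have h₂ := hammingDist_le_sub_of_step hstep (show s + d ≤ s + m by omega)
  have h₃ := hammingDist_triangle (isometricCycle m s) (isometricCycle m (s + d))
    (isometricCycle m (s + m))
  have h₄ : hammingDist (isometricCycle m s) (isometricCycle m (s + m)) = m := by
    simp [hammingDist, isometricCycle_add_self]
  omega

theorem hammingDist_isometricCycle_of_ge {m d : ℕ} (s : ℕ) (hd : m ≤ d) (hd' : d ≤ 2 * m) :
    hammingDist (isometricCycle m s) (isometricCycle m (s + d)) = 2 * m - d := by
  rw [hammingDist_comm, ← isometricCycle_add_two_mul m s 1,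
    show s + 2 * m * 1 = s + d + (2 * m - d) by omega]
  exact hammingDist_isometricCycle_of_le _ (by omega)

/-- Injectivity and inducedness of a circuit code follow from the spread condition. -/
theorem IsCircuitCode.of_adj_of_spread {n k N : ℕ} [NeZero N] (hk : 2 ≤ k)
    {C : ZMod N → Fin n → Bool} (hadj : ∀ i, hammingDist (C i) (C (i + 1)) = 1)
    (hspread : ∀ i j, hammingDist (C i) (C j) < k → cycDist i j = hammingDist (C i) (C j)) :
    IsCircuitCode n k N C where
  adj := hadj
  spread := hspread
  inj i j hij := by
    have h := hspread i j (by rw [hij, hammingDist_self]; omega)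
    rw [hij, hammingDist_self] at h
    rcases min_choice (j - i).val (i - j).val with h' | h'
    · exact (sub_eq_zero.1 ((ZMod.val_eq_zero _).1 (h'.symm.trans h))).symm
    · exact sub_eq_zero.1 ((ZMod.val_eq_zero _).1 (h'.symm.trans h))
  induced i j _ hji hij hd := by
    have h := hspread i j (by omega)
    rw [hd] at h
    have of_val {x : ZMod N} (hx : x.val = 1) : x = 1 := by
      rw [← ZMod.natCast_zmod_val x, hx, Nat.cast_one]
    rcases min_choice (j - i).val (i - j).val with h' | h'
    · exact hji (sub_eq_iff_eq_add'.1 (of_val (h'.symm.trans h)))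
    · exact hij (sub_eq_iff_eq_add'.1 (of_val (h'.symm.trans h)))

/-- Among the first `i` transitions of a cyclic word of length `N + M`, the number of those
belonging to an evenly distributed set of `M` transitions. -/
def insertedCount (N M i : ℕ) : ℕ := i * M / (N + M)

section insertedCount

variable {N M : ℕ}

theorem insertedCount_mono : Monotone (insertedCount N M) := fun _ _ h =>
  Nat.div_le_div_right (Nat.mul_le_mul_right _ h)

theorem insertedCount_add_period (hN : 0 < N) (i : ℕ) :
    insertedCount N M (i + (N + M)) = insertedCount N M i + M := by
  rw [insertedCount, add_mul, Nat.add_mul_div_left _ _ (by omega), insertedCount]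

theorem insertedCount_succ_le (hN : 0 < N) (i : ℕ) :
    insertedCount N M (i + 1) ≤ insertedCount N M i + 1 := by
  rw [insertedCount, insertedCount, ← Nat.add_div_right _ (by omega : 0 < N + M)]
  exact Nat.div_le_div_right (by rw [add_mul]; omega)

theorem insertedCount_le (i : ℕ) : insertedCount N M i ≤ i := by
  refine Nat.div_le_of_le_mul ?_
  rw [mul_comm]
  exact Nat.mul_le_mul_right _ (Nat.le_add_left M N)

theorem sub_insertedCount_mono (hN : 0 < N) :
    Monotone fun i => i - insertedCount N M i := by
  refine monotone_nat_of_le_succ fun i => ?_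
  have := insertedCount_succ_le (M := M) hN i
  have := insertedCount_le (N := N) (M := M) i
  omega

theorem insertedCount_le_add_two {q k a p s : ℕ} (hN : 0 < N) (hq : q * (k + 1) ≤ N)
    (hM : M = q * (k + 2)) (hp : p < k)
    (hs : insertedCount N M (a + (p + s)) = insertedCount N M a + s) : s ≤ p + 2 := by
  by_contra! h
  obtain ⟨t, rfl⟩ : ∃ t, s = t + p + 3 := ⟨s - p - 3, by omega⟩
  have h₁ : a * M < (insertedCount N M a + 1) * (N + M) :=
    Nat.lt_mul_of_div_lt (Nat.lt_succ_self _) (by omega)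
  have h₂ := Nat.div_mul_le_self ((a + (p + (t + p + 3))) * M) (N + M)
  change insertedCount N M _ * _ ≤ _ at h₂
  rw [hs] at h₂
  have h₃ : (p + 2) * N < (p + 1) * M := by nlinarith [Nat.zero_le (t * N)]
  have h₄ : (p + 2) * (q * (k + 1)) < (p + 1) * (q * (k + 2)) := by
    rw [← hM]
    exact (Nat.mul_le_mul_left _ hq).trans_lt h₃
  have h₅ : q * p ≤ q * k := Nat.mul_le_mul_left _ hp.le
  nlinarith

end insertedCount

section Extension

variable {n N : ℕ} (C : ZMod N → Fin n → Bool) (m M : ℕ)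

/-- The cycle `C` extended by `m` coordinates, with `M` transitions in the new coordinates
distributed evenly among those of `C`. -/
def extendedCycle (i : ℕ) : Fin (n + m) → Bool :=
  Fin.append (C ((i - insertedCount N M i : ℕ) : ZMod N)) (isometricCycle m (insertedCount N M i))

variable {C m M}

theorem extendedCycle_add_period {q : ℕ} (hN : 0 < N) (hM : M = 2 * m * q) (i : ℕ) :
    extendedCycle C m M (i + (N + M)) = extendedCycle C m M i := by
  have h := insertedCount_le (N := N) (M := M) i
  have hP : i + (N + M) - (insertedCount N M i + M) = i - insertedCount N M i + N := by omega
  rw [extendedCycle, insertedCount_add_period hN, hP, Nat.cast_add, ZMod.natCast_self, add_zero,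
    extendedCycle]
  congr 1
  rw [hM, isometricCycle_add_two_mul]

theorem extendedCycle_mod {q : ℕ} (hN : 0 < N) (hM : M = 2 * m * q) (i : ℕ) :
    extendedCycle C m M (i % (N + M)) = extendedCycle C m M i :=
  Function.Periodic.map_mod_nat (extendedCycle_add_period hN hM) i

theorem hammingDist_extendedCycle_succ (hN : 0 < N) (hm : 0 < m)
    (hadj : ∀ i, hammingDist (C i) (C (i + 1)) = 1) (i : ℕ) :
    hammingDist (extendedCycle C m M i) (extendedCycle C m M (i + 1)) = 1 := by
  have h₁ := insertedCount_le (N := N) (M := M) i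
  have h₂ := insertedCount_succ_le (M := M) hN i
  have h₃ := insertedCount_mono (N := N) (M := M) (Nat.le_succ i)
  rw [extendedCycle, extendedCycle, hammingDist_append]
  rcases h₃.eq_or_lt with h | h
  · rw [← h, show i.succ - insertedCount N M i = i - insertedCount N M i + 1 by omega,
      Nat.cast_succ, hadj, hammingDist_self]
  · have h' : insertedCount N M (i + 1) = insertedCount N M i + 1 := le_antisymm h₂ h
    rw [h', Nat.add_sub_add_right, hammingDist_self, hammingDist_isometricCycle_of_le _ hm]

theorem hammingDist_extendedCycle_of_lt {q k a b : ℕ} (hN : 0 < N) (hq : q * (k + 1) ≤ N)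
    (hm : 2 * m = k + 2) (hM : M = 2 * m * q) (hab : a ≤ b)
    (hlt : hammingDist (extendedCycle C m M a) (extendedCycle C m M b) < k)
    (hC : hammingDist (C ((a - insertedCount N M a : ℕ) : ZMod N))
      (C ((b - insertedCount N M b : ℕ) : ZMod N)) =
        b - insertedCount N M b - (a - insertedCount N M a)) :
    hammingDist (extendedCycle C m M a) (extendedCycle C m M b) = b - a := by
  have ha := insertedCount_le (N := N) (M := M) a
  have hb := insertedCount_le (N := N) (M := M) b
  have hP := sub_insertedCount_mono (M := M) hN hab
  dsimp only at hP
  rw [extendedCycle, extendedCycle, hammingDist_append, hC] at hlt ⊢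
  obtain ⟨s, hs⟩ := Nat.exists_eq_add_of_le (insertedCount_mono (N := N) (M := M) hab)
  have hsle : s ≤ b - insertedCount N M b - (a - insertedCount N M a) + 2 := by
    refine insertedCount_le_add_two (M := M) (a := a) hN hq (by rw [hM, hm, mul_comm])
      (by omega) ?_
    rw [← hs]
    congr 1
    omega
  rcases le_total s m with h | h
  · rw [hs, hammingDist_isometricCycle_of_le _ h]
    omega
  · rw [hs, hammingDist_isometricCycle_of_ge _ h (by omega)] at hlt
    omega

end Extension

/-- Extending a circuit code by `m = (k + 2) / 2` coordinates and `M = (k + 2) * q` evenly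
distributed transitions gives a circuit code as long as `q * (k + 1) ≤ N`. -/
theorem IsCircuitCode.extend {n k N m q : ℕ} [NeZero N] {C : ZMod N → Fin n → Bool}
    (hC : IsCircuitCode n k N C) (hk : 2 ≤ k) (hm : 2 * m = k + 2) (hq : q * (k + 1) ≤ N) :
    IsCircuitCode (n + m) k (N + 2 * m * q)
      fun i => extendedCycle C m (2 * m * q) i.val := by
  have hN : 0 < N := NeZero.pos N
  have hstep := hammingDist_extendedCycle_succ (M := 2 * m * q) hN (by omega : 0 < m) hC.adj
  have hperiod := extendedCycle_add_period (C := C) hN (rfl : 2 * m * q = 2 * m * q)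
  have hmod := extendedCycle_mod (C := C) hN (rfl : 2 * m * q = 2 * m * q)
  have hcount := insertedCount_add_period (M := 2 * m * q) hN
  have hkey := fun a b => hammingDist_extendedCycle_of_lt (C := C) (a := a) (b := b) hN hq hm rfl
  have hPmono := sub_insertedCount_mono (M := 2 * m * q) hN
  have hle := insertedCount_le (N := N) (M := 2 * m * q)
  generalize 2 * m * q = M at *
  have : NeZero (N + M) := ⟨by omega⟩
  refine .of_adj_of_spread hk (fun i => ?_) ?_
  · rw [← hstep i.val, ← hmod (i.val + 1), ← ZMod.val_natCast, Nat.cast_succ,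
      ZMod.natCast_zmod_val]
  suffices h : ∀ i j : ZMod (N + M), i.val ≤ j.val →
      hammingDist (extendedCycle C m M i.val) (extendedCycle C m M j.val) < k →
      cycDist i j = hammingDist (extendedCycle C m M i.val) (extendedCycle C m M j.val) by
    intro i j hlt
    rcases le_total i.val j.val with hij | hij
    · exact h i j hij hlt
    · rw [cycDist_comm, hammingDist_comm]
      exact h j i hij (by rwa [hammingDist_comm])
  intro i j hij hlt
  have hj := ZMod.val_lt j
  have hcyc := cycDist_natCast hij (by omega : j.val ≤ i.val + (N + M))
  rw [ZMod.natCast_zmod_val, ZMod.natCast_zmod_val] at hcyc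
  rw [hcyc]
  clear hcyc
  generalize i.val = a at *
  generalize j.val = b at *
  have hab := hammingDist_le_sub_of_step (fun i => (hstep i).le) hij
  have hba := hammingDist_le_sub_of_step (fun i => (hstep i).le) (by omega : b ≤ a + (N + M))
  rw [hperiod, hammingDist_comm] at hba
  have hPab := hPmono hij
  have hPba := hPmono (by omega : b ≤ a + (N + M))
  have ha := hle a
  have hb := hle b
  have hPperiod : a + (N + M) - insertedCount N M (a + (N + M)) =
      a - insertedCount N M a + N := by rw [hcount]; omega
  dsimp only at hPab hPba
  rw [hPperiod] at hPba
  have hold := hC.spread ((a - insertedCount N M a : ℕ) : ZMod N)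
    ((b - insertedCount N M b : ℕ) : ZMod N) (by
      rw [extendedCycle, extendedCycle, hammingDist_append] at hlt
      omega)
  rw [cycDist_natCast hPab hPba] at hold
  rcases le_total (b - insertedCount N M b - (a - insertedCount N M a))
    (N - (b - insertedCount N M b - (a - insertedCount N M a))) with h | h
  · rw [min_eq_left h] at hold
    have := hkey a b hij hlt hold.symm
    omega
  · rw [min_eq_right h] at hold
    have := hkey b (a + (N + M)) (by omega)
      (by rwa [hperiod, hammingDist_comm]) (by
        rw [hPperiod, Nat.cast_add _ N, ZMod.natCast_self, add_zero, hammingDist_comm, ← hold]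
        omega)
    rw [hperiod, hammingDist_comm] at this
    omega

theorem stmt_9 (n k N : ℕ) (hk : 2 ≤ k) (heven : Even k) (h : ExistsCircuitCode n k N) :
    ExistsCircuitCode (n + (k + 2) / 2) k (N + (k + 2) * (N / (k + 1))) := by
  obtain ⟨C, hC⟩ := h
  have hN : NeZero N := ⟨by
    rintro rfl
    exact not_injective_infinite_finite (α := ℤ) C hC.inj⟩
  have hm : 2 * ((k + 2) / 2) = k + 2 := by
    obtain ⟨r, rfl⟩ := heven
    omega
  have := hC.extend hk hm (Nat.div_mul_le_self N (k + 1))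
  rw [hm] at this
  exact ⟨_, this⟩
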